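/- For every α, β > 0, every θ ∈ (0,α) and λ ∈ (0,β) with θ/α + λ/β ≤ 1, and every ε > 0, there exists a constant C_ε > 0 such that for all τ ∈ ℝ and all ξ ∈ ℝⁿ, (1 + |τ|^{2θ})(1 + |ξ|^{2λ}) ≤ ε² (1 + |τ|^{2α}) + C_ε (1 + |ξ|^{2β}). -/

import Mathlib

theorem aux_one_add_rpow (x a b : ℝ) (hx : 0 ≤ x) (ha : 0 < a) (hb : 0 < b) :
    1 + x ^ (2 * b) ≤ 2 * (1 + x ^ (2 * a)) ^ (b / a) := by
  have h0 : 0 ≤ x ^ (2 * a) := Real.rpow_nonneg hx _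
  have hs : 0 ≤ b / a := by positivity
  have h1 : 1 ≤ (1 + x ^ (2 * a)) ^ (b / a) := Real.one_le_rpow (by linarith) hs
  have h2 : (x ^ (2 * a)) ^ (b / a) ≤ (1 + x ^ (2 * a)) ^ (b / a) :=
    Real.rpow_le_rpow h0 (by linarith) hs
  rw [← Real.rpow_mul hx] at h2
  have h3 : 2 * a * (b / a) = 2 * b := by field_simp
  rw [h3] at h2
  linarith

/-- For every `α, β > 0`, every `θ ∈ (0,α)` and `λ ∈ (0,β)` with
`θ/α + λ/β ≤ 1`, and every `ε > 0`, there is a constant `C_ε > 0` such that for all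
`τ ∈ ℝ` and `ξ ∈ ℝⁿ`,
`(1 + |τ|^{2θ})(1 + |ξ|^{2λ}) ≤ ε² (1 + |τ|^{2α}) + C_ε (1 + |ξ|^{2β})`. -/
theorem fourier_side_interpolation_inequality
    (α β θ lam : ℝ) (hα : 0 < α) (hβ : 0 < β)
    (hθ : θ ∈ Set.Ioo 0 α) (hlam : lam ∈ Set.Ioo 0 β)
    (hsum : θ / α + lam / β ≤ 1) (ε : ℝ) (hε : 0 < ε) :
    ∃ C : ℝ, 0 < C ∧ ∀ (n : ℕ) (τ : ℝ) (ξ : EuclideanSpace ℝ (Fin n)),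
      (1 + |τ| ^ (2 * θ)) * (1 + ‖ξ‖ ^ (2 * lam))
        ≤ ε ^ 2 * (1 + |τ| ^ (2 * α)) + C * (1 + ‖ξ‖ ^ (2 * β)) := by
  obtain ⟨hθ0, hθ1⟩ := hθ
  obtain ⟨hl0, hl1⟩ := hlam
  have hs0 : 0 < θ / α := by positivity
  have hs1 : θ / α < 1 := (div_lt_one hα).2 hθ1
  have hδ : 0 < ε ^ 2 := by positivity
  set s := θ / α with hs
  have hs2 : 0 < 1 - s := by linarith
  have hK : 0 < (4 / (ε ^ 2) ^ s) ^ (1 / (1 - s)) := by positivity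
  refine ⟨(4 / (ε ^ 2) ^ s) ^ (1 / (1 - s)), hK, fun n τ ξ => ?_⟩
  have hKs : ((4 / (ε ^ 2) ^ s) ^ (1 / (1 - s))) ^ (1 - s) = 4 / (ε ^ 2) ^ s := by
    rw [← Real.rpow_mul (by positivity), one_div_mul_cancel hs2.ne', Real.rpow_one]
  set K := (4 / (ε ^ 2) ^ s) ^ (1 / (1 - s))
  have h1 := aux_one_add_rpow |τ| α θ (abs_nonneg _) hα hθ0
  have h2 := aux_one_add_rpow ‖ξ‖ β lam (norm_nonneg _) hβ hl0
  have hA : 1 ≤ 1 + |τ| ^ (2 * α) := by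
    have := Real.rpow_nonneg (abs_nonneg τ) (2 * α)
    linarith
  have hB : 1 ≤ 1 + ‖ξ‖ ^ (2 * β) := by
    have := Real.rpow_nonneg (norm_nonneg ξ) (2 * β)
    linarith
  rw [← hs] at h1
  set A := 1 + |τ| ^ (2 * α)
  set B := 1 + ‖ξ‖ ^ (2 * β)
  have hA0 : 0 < A := by linarith
  have hB0 : 0 < B := by linarith
  have h3 : B ^ (lam / β) ≤ B ^ (1 - s) :=
    Real.rpow_le_rpow_of_exponent_le hB (by linarith)
  have h4 : (ε ^ 2 * A) ^ s * (K * B) ^ (1 - s) ≤ s * (ε ^ 2 * A) + (1 - s) * (K * B) :=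
    Real.geom_mean_le_arith_mean2_weighted hs0.le hs2.le (by positivity) (by positivity)
      (by ring)
  have h5 : (ε ^ 2 * A) ^ s * (K * B) ^ (1 - s) = (2 * A ^ s) * (2 * B ^ (1 - s)) := by
    rw [Real.mul_rpow hδ.le hA0.le, Real.mul_rpow hK.le hB0.le, hKs]
    have : (ε ^ 2) ^ s ≠ 0 := (Real.rpow_pos_of_pos hδ s).ne'
    generalize (ε ^ 2) ^ s = D at *
    field_simp
    ring
  have h6 : 0 < ε ^ 2 * A := by positivity
  have h7 : 0 < K * B := by positivity
  have hn : 0 ≤ 1 + ‖ξ‖ ^ (2 * lam) := by positivity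
  calc _ ≤ (2 * A ^ s) * (2 * B ^ (1 - s)) :=
        mul_le_mul h1 (by linarith) hn (by positivity)
    _ ≤ s * (ε ^ 2 * A) + (1 - s) * (K * B) := h5 ▸ h4
    _ ≤ _ := by nlinarith
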